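/- The operator C_q = (1 − P_q)/2 − Q_q/(2r) on V ⊗ V is an idempotent: C_q ∘ C_q = C_q. -/

import Mathlib

open scoped BigOperators

noncomputable section

/-- The index set `I = {-r, …, -1, 1, …, r}` as a subtype of `ℤ`. -/
abbrev SIdx (r : ℕ) : Type := {i : ℤ // i ∈ (Finset.Icc (-(r : ℤ)) (r : ℤ)).erase 0}

instance (r : ℕ) : Neg (SIdx r) :=
  ⟨fun i => ⟨-i.1, by
    obtain ⟨h1, h2⟩ := Finset.mem_erase.mp i.2
    rw [Finset.mem_Icc] at h2
    exact Finset.mem_erase.mpr ⟨neg_ne_zero.mpr h1, Finset.mem_Icc.mpr (by omega)⟩⟩⟩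

/-- The sign `ε_i`: `1` for `i > 0` and `-1` for `i < 0`, as an element of `K`. -/
def sgn (K : Type*) [Field K] {r : ℕ} (i : SIdx r) : K := if 0 < i.1 then 1 else -1

/-- A symplectic parameter family `q = (q_{ij}, q_i)`: nonzero scalars with
`q_{ij} = q_{ji}⁻¹`, `q_{ii} = 1`, `q_{-i} = q_i⁻¹` and `q_{-i,j} = q_{ij}⁻¹ q_j²`. -/
structure SympParam (K : Type*) [Field K] (r : ℕ) where
  qm : SIdx r → SIdx r → K
  qv : SIdx r → K
  qm_ne : ∀ i j, qm i j ≠ 0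
  qv_ne : ∀ i, qv i ≠ 0
  qm_symm : ∀ i j, qm i j = (qm j i)⁻¹
  qm_diag : ∀ i, qm i i = 1
  qv_neg : ∀ i, qv (-i) = (qv i)⁻¹
  qm_neg : ∀ i j, qm (-i) j = (qm i j)⁻¹ * (qv j) ^ 2

variable {K : Type*} [Field K] [CharZero K] {r : ℕ}

/-- The operator `P_q` on `V ⊗ V`, where `V = SIdx r → K` and `V ⊗ V` is realized as
`(SIdx r × SIdx r) → K` with basis vector `e l ⊗ e m = Pi.single (l, m) 1`.  It sends
`e l ⊗ e m ↦ q_{lm} • (e m ⊗ e l)`. -/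
def Pq (q : SympParam K r) : Module.End K (SIdx r × SIdx r → K) where
  toFun f := fun p => q.qm p.2 p.1 * f (p.2, p.1)
  map_add' f g := by funext p; simp [mul_add]
  map_smul' c f := by funext p; simp [smul_eq_mul]; ring

/-- The operator `Q_q` on `V ⊗ V`: it sends
`e l ⊗ e m ↦ δ_{m,-l} ε_l q_l⁻¹ • ∑ i, ε_i q_i • (e i ⊗ e (-i))`. -/
def Qq (q : SympParam K r) : Module.End K (SIdx r × SIdx r → K) where
  toFun f := fun p =>
    if p.2 = -p.1 then
      sgn K p.1 * q.qv p.1 * ∑ l : SIdx r, sgn K l * (q.qv l)⁻¹ * f (l, -l)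
    else 0
  map_add' f g := by
    funext p
    by_cases h : p.2 = -p.1 <;> simp [h, mul_add, Finset.sum_add_distrib]
  map_smul' c f := by
    funext p
    by_cases h : p.2 = -p.1 <;>
      simp only [h, if_true, if_false, Pi.smul_apply, smul_eq_mul, RingHom.id_apply,
        Finset.mul_sum, mul_zero]
    · exact Finset.sum_congr rfl fun l _ => by ring

/-- The idempotent `C_q = (1 − P_q)/2 − Q_q/(2r)` on `V ⊗ V`. -/
def Cq (q : SympParam K r) : Module.End K (SIdx r × SIdx r → K) :=
  (2 : K)⁻¹ • (1 - Pq q) - (2 * (r : K))⁻¹ • Qq q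

theorem SIdx.neg_neg (i : SIdx r) : -(-i) = i :=
  Subtype.ext (_root_.neg_neg i.1)

theorem SIdx.neg_involutive (r : ℕ) : Function.Involutive (fun i : SIdx r => -i) :=
  SIdx.neg_neg

theorem SIdx.card (r : ℕ) : Fintype.card (SIdx r) = 2 * r := by
  rw [Fintype.card_coe, Finset.card_erase_of_mem (by simp), Int.card_Icc]
  omega

theorem sgn_neg (K : Type*) [Field K] {r : ℕ} (i : SIdx r) : sgn K (-i) = -sgn K i := by
  have h0 : i.1 ≠ 0 := (Finset.mem_erase.mp i.2).1
  have hv : (-i).1 = -i.1 := rfl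
  unfold sgn
  rw [hv]
  split_ifs <;> first | omega | simp

theorem sgn_mul_self (K : Type*) [Field K] {r : ℕ} (i : SIdx r) : sgn K i * sgn K i = 1 := by
  unfold sgn
  split_ifs <;> simp

theorem SympParam.qm_neg_self {K : Type*} [Field K] {r : ℕ} (q : SympParam K r) (i : SIdx r) :
    q.qm (-i) i = q.qv i ^ 2 := by
  simp [q.qm_neg, q.qm_diag]

theorem Pq_mul_Pq {K : Type*} [Field K] {r : ℕ} (q : SympParam K r) :
    Pq q * Pq q = 1 := by
  refine LinearMap.ext fun f => ?_
  funext p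
  change q.qm p.2 p.1 * (q.qm p.1 p.2 * f (p.1, p.2)) = f p
  rw [q.qm_symm p.2 p.1, inv_mul_cancel_left₀ (q.qm_ne _ _)]

theorem Pq_mul_Qq (q : SympParam K r) : Pq q * Qq q = -Qq q := by
  refine LinearMap.ext fun f => ?_
  funext ⟨a, b⟩
  change q.qm b a * (if a = -b then sgn K b * q.qv b * _ else 0)
    = -(if b = -a then sgn K a * q.qv a * _ else 0)
  by_cases h : b = -a
  · subst h
    rw [if_pos (SIdx.neg_neg a).symm, if_pos rfl, q.qm_neg_self, sgn_neg, q.qv_neg]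
    have := q.qv_ne a
    field_simp
  · rw [if_neg h, if_neg fun h' => h (by rw [h', SIdx.neg_neg])]
    simp

theorem Qq_mul_Pq (q : SympParam K r) : Qq q * Pq q = -Qq q := by
  refine LinearMap.ext fun f => ?_
  have hsum : ∑ l : SIdx r, sgn K l * (q.qv l)⁻¹ * (q.qm (-l) l * f (-l, l))
      = -∑ l : SIdx r, sgn K l * (q.qv l)⁻¹ * f (l, -l) := by
    rw [← Finset.sum_neg_distrib]
    refine Fintype.sum_equiv (SIdx.neg_involutive r).toPerm _ _ fun l => ?_
    rw [Function.Involutive.coe_toPerm, SIdx.neg_neg, sgn_neg, q.qv_neg, q.qm_neg_self, inv_inv]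
    have := q.qv_ne l
    field_simp
  funext p
  change (if p.2 = -p.1 then sgn K p.1 * q.qv p.1 *
      ∑ l : SIdx r, sgn K l * (q.qv l)⁻¹ * (q.qm (-l) l * f (-l, l)) else 0)
    = -(if p.2 = -p.1 then _ else 0)
  rw [hsum]
  split_ifs <;> simp

theorem Qq_mul_Qq (q : SympParam K r) : Qq q * Qq q = (2 * (r : K)) • Qq q := by
  refine LinearMap.ext fun f => ?_
  have hsum (S : K) : ∑ l : SIdx r, sgn K l * (q.qv l)⁻¹ *
      (if -l = -l then sgn K l * q.qv l * S else 0) = 2 * (r : K) * S := by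
    have hterm (l : SIdx r) : sgn K l * (q.qv l)⁻¹ *
        (if -l = -l then sgn K l * q.qv l * S else 0) = S := by
      rw [if_pos rfl]
      calc _ = (sgn K l * sgn K l) * ((q.qv l)⁻¹ * q.qv l) * S := by ring
        _ = S := by rw [sgn_mul_self, inv_mul_cancel₀ (q.qv_ne l), one_mul, one_mul]
    rw [Finset.sum_congr rfl fun l _ => hterm l, Finset.sum_const, Finset.card_univ, SIdx.card,
      nsmul_eq_mul, Nat.cast_mul, Nat.cast_ofNat]
  funext p
  change (if p.2 = -p.1 then sgn K p.1 * q.qv p.1 *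
      ∑ l : SIdx r, sgn K l * (q.qv l)⁻¹ *
        (if -l = -l then sgn K l * q.qv l * _ else 0) else 0)
    = (2 * (r : K)) * (if p.2 = -p.1 then _ else 0)
  rw [hsum]
  split_ifs
  · ring
  · simp

/-- `C_q` is an idempotent: `C_q ∘ C_q = C_q`. -/
theorem Cq_idem (hr : 1 ≤ r) (q : SympParam K r) : Cq q ∘ₗ Cq q = Cq q := by
  have hr0 : (r : K) ≠ 0 := Nat.cast_ne_zero.mpr (by omega)
  change Cq q * Cq q = Cq q
  simp only [Cq, sub_mul, mul_sub, smul_mul_assoc, mul_smul_comm, one_mul, mul_one,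
    Pq_mul_Pq, Pq_mul_Qq, Qq_mul_Pq, Qq_mul_Qq]
  match_scalars <;> field_simp <;> ring
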